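/- Let v : ℝ × U → ℝ³ be a smooth time-dependent vector field. Then [D_t, curl]v := D_t(curl v) − curl(D_t v) = −(∇v)ᵀ(curl v) − (curl v)(∇v) pointwise on ℝ × U; componentwise, for all i, j: D_t(∂_j v^i − ∂_i v^j) − (∂_j (D_t v)^i − ∂_i (D_t v)^j) = −∂_i v^k (∂_j v^k − ∂_k v^j) − (∂_k v^i − ∂_i v^k) ∂_j v^k. -/

import Mathlib

/-- Spatial partial derivative `∂_j f` of a scalar function on `ℝ × ℝ³`. -/
noncomputable def pdx (j : Fin 3) (f : ℝ × (Fin 3 → ℝ) → ℝ) (p : ℝ × (Fin 3 → ℝ)) : ℝ :=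
  fderiv ℝ f p (0, Pi.single j 1)

/-- Time partial derivative `∂_t f` of a scalar function on `ℝ × ℝ³`. -/
noncomputable def pdt (f : ℝ × (Fin 3 → ℝ) → ℝ) (p : ℝ × (Fin 3 → ℝ)) : ℝ :=
  fderiv ℝ f p (1, 0)

/-- Material derivative `D_t f = ∂_t f + vᵏ ∂_k f` along the velocity field `v`. -/
noncomputable def Dt (v : ℝ × (Fin 3 → ℝ) → Fin 3 → ℝ) (f : ℝ × (Fin 3 → ℝ) → ℝ)
    (p : ℝ × (Fin 3 → ℝ)) : ℝ :=
  pdt f p + ∑ k : Fin 3, v p k * pdx k f p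

theorem fderiv_fderiv_apply_const {E : Type*} [NormedAddCommGroup E] [NormedSpace ℝ E]
    {f : E → ℝ} {p : E} (hf : DifferentiableAt ℝ (fderiv ℝ f) p) (a b : E) :
    fderiv ℝ (fun q => fderiv ℝ f q a) p b = fderiv ℝ (fderiv ℝ f) p b a := by
  rw [fderiv_clm_apply hf (differentiableAt_const a)]
  simp

theorem differentiableAt_pdx {f : ℝ × (Fin 3 → ℝ) → ℝ} {p : ℝ × (Fin 3 → ℝ)}
    (hf : DifferentiableAt ℝ (fderiv ℝ f) p) (j : Fin 3) : DifferentiableAt ℝ (pdx j f) p :=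
  hf.clm_apply (differentiableAt_const _)

theorem differentiableAt_pdt {f : ℝ × (Fin 3 → ℝ) → ℝ} {p : ℝ × (Fin 3 → ℝ)}
    (hf : DifferentiableAt ℝ (fderiv ℝ f) p) : DifferentiableAt ℝ (pdt f) p :=
  hf.clm_apply (differentiableAt_const _)

theorem Dt_sub (v : ℝ × (Fin 3 → ℝ) → Fin 3 → ℝ) {f g : ℝ × (Fin 3 → ℝ) → ℝ}
    {p : ℝ × (Fin 3 → ℝ)} (hf : DifferentiableAt ℝ f p) (hg : DifferentiableAt ℝ g p) :
    Dt v (fun q => f q - g q) p = Dt v f p - Dt v g p := by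
  simp only [Dt, pdt, pdx, fderiv_fun_sub hf hg, sub_apply, mul_sub,
    Finset.sum_sub_distrib]
  ring

/-- The commutator `[D_t, ∂_j] f = -∂_j vᵏ ∂_k f`. -/
theorem Dt_pdx_sub_pdx_Dt {v : ℝ × (Fin 3 → ℝ) → Fin 3 → ℝ} {f : ℝ × (Fin 3 → ℝ) → ℝ}
    {p : ℝ × (Fin 3 → ℝ)} (hv : DifferentiableAt ℝ v p) (hf : ContDiffAt ℝ 2 f p) (j : Fin 3) :
    Dt v (pdx j f) p - pdx j (Dt v f) p
      = -∑ k : Fin 3, pdx j (fun r => v r k) p * pdx k f p := by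
  have hf' : DifferentiableAt ℝ (fderiv ℝ f) p :=
    (hf.fderiv_right (m := 1) (by norm_num)).differentiableAt (by norm_num)
  have hsymm : IsSymmSndFDerivAt ℝ f p := hf.isSymmSndFDerivAt (by simp)
  have hvk (k : Fin 3) : DifferentiableAt ℝ (fun r => v r k) p := differentiableAt_pi.1 hv k
  have hmul (k : Fin 3) : DifferentiableAt ℝ (fun q => v q k * pdx k f q) p :=
    (hvk k).mul (differentiableAt_pdx hf' k)
  have hpdx (k : Fin 3) : pdx j (pdx k f) p = pdx k (pdx j f) p :=
    (fderiv_fderiv_apply_const hf' _ _).trans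
      ((hsymm.eq _ _).trans (fderiv_fderiv_apply_const hf' _ _).symm)
  have hpdt : pdx j (pdt f) p = pdt (pdx j f) p :=
    (fderiv_fderiv_apply_const hf' _ _).trans
      ((hsymm.eq _ _).trans (fderiv_fderiv_apply_const hf' _ _).symm)
  have hprod (k : Fin 3) : pdx j (fun q => v q k * pdx k f q) p
      = v p k * pdx k (pdx j f) p + pdx j (fun r => v r k) p * pdx k f p := by
    rw [← hpdx k, pdx, fderiv_fun_mul (hvk k) (differentiableAt_pdx hf' k)]
    simp only [add_apply, smul_apply, smul_eq_mul]
    rw [mul_comm (pdx k f p)]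
    rfl
  have hDt : pdx j (Dt v f) p
      = pdx j (pdt f) p + ∑ k : Fin 3, pdx j (fun q => v q k * pdx k f q) p := by
    have h : Dt v f = fun q => pdt f q + ∑ k : Fin 3, v q k * pdx k f q := rfl
    rw [h, pdx, fderiv_fun_add (differentiableAt_pdt hf')
      (DifferentiableAt.fun_sum fun k _ => hmul k), fderiv_fun_sum fun k _ => hmul k]
    simp only [add_apply, sum_apply]
    rfl
  rw [hDt, hpdt, Finset.sum_congr rfl fun k _ => hprod k, Finset.sum_add_distrib, Dt]
  ring

/-- [D_t, curl]v = −(∇v)ᵀ(curl v) − (curl v)(∇v), componentwise: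
D_t(∂_j vⁱ − ∂_i vʲ) − (∂_j (D_t v)ⁱ − ∂_i (D_t v)ʲ)
  = −∂_i vᵏ (∂_j vᵏ − ∂_k vʲ) − (∂_k vⁱ − ∂_i vᵏ) ∂_j vᵏ. -/
theorem commutator_Dt_curl_v (U : Set (Fin 3 → ℝ)) (hU : IsOpen U)
    (v : ℝ × (Fin 3 → ℝ) → Fin 3 → ℝ)
    (hv : ContDiffOn ℝ (⊤ : ℕ∞) v (Set.univ ×ˢ U)) :
    ∀ t : ℝ, ∀ x ∈ U, ∀ i j : Fin 3,
      Dt v (fun q => pdx j (fun r => v r i) q - pdx i (fun r => v r j) q) (t, x)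
        - (pdx j (fun q => Dt v (fun r => v r i) q) (t, x)
            - pdx i (fun q => Dt v (fun r => v r j) q) (t, x))
      = -(∑ k : Fin 3, pdx i (fun r => v r k) (t, x) *
            (pdx j (fun r => v r k) (t, x) - pdx k (fun r => v r j) (t, x)))
        - ∑ k : Fin 3, (pdx k (fun r => v r i) (t, x) - pdx i (fun r => v r k) (t, x)) *
            pdx j (fun r => v r k) (t, x) := by
  intro t x hx i j
  have hvp : ContDiffAt ℝ 2 v (t, x) :=
    (hv.contDiffAt ((isOpen_univ.prod hU).mem_nhds ⟨Set.mem_univ t, hx⟩)).of_le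
      (WithTop.coe_le_coe.2 (le_top (a := (2 : ℕ∞))))
  have hvd : DifferentiableAt ℝ v (t, x) := hvp.differentiableAt (by norm_num)
  have hvk (k : Fin 3) : ContDiffAt ℝ 2 (fun r => v r k) (t, x) := contDiffAt_pi.1 hvp k
  have hvk' (k : Fin 3) : DifferentiableAt ℝ (fderiv ℝ fun r => v r k) (t, x) :=
    ((hvk k).fderiv_right (m := 1) (by norm_num)).differentiableAt (by norm_num)
  rw [Dt_sub v (differentiableAt_pdx (hvk' i) j) (differentiableAt_pdx (hvk' j) i)]
  have hi := Dt_pdx_sub_pdx_Dt hvd (hvk i) j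
  have hj := Dt_pdx_sub_pdx_Dt hvd (hvk j) i
  simp only [Fin.sum_univ_three] at hi hj ⊢
  linear_combination hi - hj
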